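/- Let k be a field of characteristic 3 and B = k⟨X,Y⟩/⟨X³, Y³, XY+YX⟩. Then B is a symmetric k-algebra: the linear form s : B → k sending x²y² to 1 and all other monomials of the basis {1, x, y, x², xy, y², x²y, xy², x²y²} to 0 satisfies s(uv) = s(vu) for all u, v ∈ B, and its kernel contains no nonzero left ideal. -/

import Mathlib

open Module FreeAlgebra

noncomputable section

/-- The relations X³ = 0, Y³ = 0, XY + YX = 0 in the free algebra on two
generators. -/
def Brel (k : Type) [Field k] :
    FreeAlgebra k (Fin 2) → FreeAlgebra k (Fin 2) → Prop := fun a b =>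
  b = 0 ∧ (a = ι k (0 : Fin 2) ^ 3 ∨ a = ι k (1 : Fin 2) ^ 3 ∨
    a = ι k (0 : Fin 2) * ι k (1 : Fin 2) + ι k (1 : Fin 2) * ι k (0 : Fin 2))

/-- The quantum complete intersection B = k⟨X,Y⟩/⟨X³, Y³, XY+YX⟩. -/
abbrev Balg (k : Type) [Field k] := RingQuot (Brel k)

/-- The image of X in B. -/
def xB (k : Type) [Field k] : Balg k := RingQuot.mkAlgHom k (Brel k) (ι k 0)

/-- The image of Y in B. -/
def yB (k : Type) [Field k] : Balg k := RingQuot.mkAlgHom k (Brel k) (ι k 1)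


open scoped Kronecker

lemma xB_cube (k : Type) [Field k] : xB k ^ 3 = 0 := by
  have h := RingQuot.mkAlgHom_rel k (s := Brel k) (x := ι k (0 : Fin 2) ^ 3) (y := 0)
    ⟨rfl, Or.inl rfl⟩
  simpa [xB] using h

lemma yB_cube (k : Type) [Field k] : yB k ^ 3 = 0 := by
  have h := RingQuot.mkAlgHom_rel k (s := Brel k) (x := ι k (1 : Fin 2) ^ 3) (y := 0)
    ⟨rfl, Or.inr (Or.inl rfl)⟩
  simpa [yB] using h

lemma yx_comm (k : Type) [Field k] : yB k * xB k = (-1 : k) • (xB k * yB k) := by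
  have h := RingQuot.mkAlgHom_rel k (s := Brel k)
    (x := ι k (0 : Fin 2) * ι k (1 : Fin 2) + ι k (1 : Fin 2) * ι k (0 : Fin 2)) (y := 0)
    ⟨rfl, Or.inr (Or.inr rfl)⟩
  have h' : xB k * yB k + yB k * xB k = 0 := by simpa [xB, yB] using h
  calc yB k * xB k = ((-1 : k) + 1) • (xB k * yB k) + yB k * xB k := by simp
    _ = (-1 : k) • (xB k * yB k) + (xB k * yB k + yB k * xB k) := by
      rw [add_smul, one_smul, add_assoc]
    _ = _ := by rw [h', add_zero]

lemma y_xpow (k : Type) [Field k] (i : ℕ) :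
    yB k * xB k ^ i = (-1 : k) ^ i • (xB k ^ i * yB k) := by
  induction i with
  | zero => simp
  | succ i ih =>
    rw [pow_succ, ← mul_assoc, ih, smul_mul_assoc, mul_assoc, yx_comm, pow_succ (-1 : k),
      mul_smul_comm, smul_smul, mul_assoc]

lemma ypow_x (k : Type) [Field k] (j : ℕ) :
    yB k ^ j * xB k = (-1 : k) ^ j • (xB k * yB k ^ j) := by
  induction j with
  | zero => simp
  | succ j ih =>
    rw [pow_succ', mul_assoc, ih, mul_smul_comm, ← mul_assoc, yx_comm, pow_succ (-1 : k),
      smul_mul_assoc, smul_smul, mul_assoc]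

/-- The monomials. -/
def mon (k : Type) [Field k] (i j : ℕ) : Balg k := xB k ^ i * yB k ^ j

lemma x_mon (k : Type) [Field k] (i j : ℕ) : xB k * mon k i j = mon k (i + 1) j := by
  simp [mon, pow_succ', mul_assoc]

lemma y_mon (k : Type) [Field k] (i j : ℕ) :
    yB k * mon k i j = (-1 : k) ^ i • mon k i (j + 1) := by
  rw [mon, ← mul_assoc, y_xpow, smul_mul_assoc, mul_assoc, ← pow_succ', mon]

lemma mon_y (k : Type) [Field k] (i j : ℕ) : mon k i j * yB k = mon k i (j + 1) := by
  simp [mon, pow_succ, mul_assoc]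

lemma mon_x (k : Type) [Field k] (i j : ℕ) :
    mon k i j * xB k = (-1 : k) ^ j • mon k (i + 1) j := by
  rw [mon, mul_assoc, ypow_x, mul_smul_comm, ← mul_assoc, ← pow_succ, mon]

lemma xpow_mon (k : Type) [Field k] (a i j : ℕ) :
    xB k ^ a * mon k i j = mon k (a + i) j := by
  simp [mon, pow_add, mul_assoc]

lemma ypow_mon (k : Type) [Field k] (b i j : ℕ) :
    yB k ^ b * mon k i j = ((-1 : k) ^ i) ^ b • mon k i (b + j) := by
  induction b with
  | zero => simp
  | succ b ih =>
    rw [pow_succ', mul_assoc, ih, mul_smul_comm, y_mon, smul_smul, ← pow_succ]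
    congr 2; omega

lemma mon_eq_zero (k : Type) [Field k] (i j : ℕ) (h : 3 ≤ i ∨ 3 ≤ j) : mon k i j = 0 := by
  rcases h with h | h
  · rw [mon, pow_eq_zero_of_le h (xB_cube k), zero_mul]
  · rw [mon, pow_eq_zero_of_le h (yB_cube k), mul_zero]

/-- The span of the nine standard monomials. -/
def monSpan (k : Type) [Field k] : Submodule k (Balg k) :=
  Submodule.span k (Set.range fun p : Fin 3 × Fin 3 => mon k p.1 p.2)

lemma mon_mem (k : Type) [Field k] (i j : ℕ) : mon k i j ∈ monSpan k := by
  by_cases h : 3 ≤ i ∨ 3 ≤ j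
  · rw [mon_eq_zero k i j h]; exact zero_mem _
  · push Not at h
    exact Submodule.subset_span ⟨(⟨i, h.1⟩, ⟨j, h.2⟩), rfl⟩

lemma mem_monSpan (k : Type) [Field k] (u : Balg k) : u ∈ monSpan k := by
  obtain ⟨a, rfl⟩ := RingQuot.mkAlgHom_surjective k (Brel k) u
  suffices h : ∀ u ∈ monSpan k, RingQuot.mkAlgHom k (Brel k) a * u ∈ monSpan k by
    have := h 1 (by simpa [mon] using mon_mem k 0 0)
    simpa using this
  induction a using FreeAlgebra.induction with
  | grade0 r =>
    intro u hu
    rw [AlgHom.commutes, ← Algebra.smul_def]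
    exact Submodule.smul_mem _ _ hu
  | grade1 t =>
    intro u hu
    induction hu using Submodule.span_induction with
    | mem v hv =>
      obtain ⟨p, rfl⟩ := hv
      fin_cases t
      · change xB k * mon k _ _ ∈ _
        rw [x_mon]; exact mon_mem _ _ _
      · change yB k * mon k _ _ ∈ _
        rw [y_mon]; exact Submodule.smul_mem _ _ (mon_mem _ _ _)
    | zero => simp
    | add v w _ _ hv hw => rw [mul_add]; exact add_mem hv hw
    | smul c v _ hv => rw [mul_smul_comm]; exact Submodule.smul_mem _ _ hv
  | mul a b ha hb =>
    intro u hu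
    rw [map_mul, mul_assoc]
    exact ha _ (hb _ hu)
  | add a b ha hb =>
    intro u hu
    rw [map_add, add_mul]
    exact add_mem (ha _ hu) (hb _ hu)

/-- The nilpotent shift. -/
def shiftN (k : Type) [Field k] : Matrix (Fin 3) (Fin 3) k := !![0, 0, 0; 1, 0, 0; 0, 1, 0]

/-- The sign matrix. -/
def signD (k : Type) [Field k] : Matrix (Fin 3) (Fin 3) k := !![1, 0, 0; 0, -1, 0; 0, 0, 1]

lemma shiftN_cube (k : Type) [Field k] : shiftN k ^ 3 = 0 := by
  ext i j
  fin_cases i <;> fin_cases j <;>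
    simp [shiftN, pow_succ, Matrix.mul_apply, Fin.sum_univ_three]

lemma sign_shift (k : Type) [Field k] :
    shiftN k * signD k + signD k * shiftN k = 0 := by
  ext i j
  fin_cases i <;> fin_cases j <;>
    simp [shiftN, signD, Matrix.mul_apply, Fin.sum_univ_three]

lemma kron_pow (k : Type) [Field k] (A B : Matrix (Fin 3) (Fin 3) k) (n : ℕ) :
    (A ⊗ₖ B) ^ n = (A ^ n) ⊗ₖ (B ^ n) := by
  induction n with
  | zero => simp
  | succ n ih => rw [pow_succ, ih, ← Matrix.mul_kronecker_mul, ← pow_succ, ← pow_succ]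

/-- The images of the generators. -/
def genMat (k : Type) [Field k] : Fin 2 → Matrix (Fin 3 × Fin 3) (Fin 3 × Fin 3) k :=
  ![shiftN k ⊗ₖ 1, signD k ⊗ₖ shiftN k]

/-- The regular representation of B by matrices. -/
def rhoB (k : Type) [Field k] : Balg k →ₐ[k] Matrix (Fin 3 × Fin 3) (Fin 3 × Fin 3) k :=
  RingQuot.liftAlgHom k ⟨FreeAlgebra.lift k (genMat k), by
    rintro a b ⟨rfl, rfl | rfl | rfl⟩
    · simp [genMat, kron_pow, shiftN_cube]
    · simp [genMat, kron_pow, shiftN_cube]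
    · simp only [map_add, map_mul, FreeAlgebra.lift_ι_apply, map_zero]
      simp only [genMat, Matrix.cons_val_zero, Matrix.cons_val_one, ← Matrix.mul_kronecker_mul,
        one_mul, mul_one, ← Matrix.add_kronecker, sign_shift, Matrix.zero_kronecker]⟩

lemma rhoB_x (k : Type) [Field k] : rhoB k (xB k) = shiftN k ⊗ₖ 1 := by
  simp [rhoB, xB, genMat]

lemma rhoB_y (k : Type) [Field k] : rhoB k (yB k) = signD k ⊗ₖ shiftN k := by
  simp [rhoB, yB, genMat]

/-- The symmetrizing form. -/
def formS (k : Type) [Field k] : Balg k →ₗ[k] k :=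
  (Matrix.entryLinearMap k k ((2, 2) : Fin 3 × Fin 3) ((0, 0) : Fin 3 × Fin 3)) ∘ₗ
    (rhoB k).toLinearMap

lemma formS_mon (k : Type) [Field k] (i j : ℕ) :
    formS k (mon k i j) = if i = 2 ∧ j = 2 then 1 else 0 := by
  by_cases h : 3 ≤ i ∨ 3 ≤ j
  · rw [mon_eq_zero k i j h, if_neg (by omega), map_zero]
  · push Not at h
    obtain ⟨hi, hj⟩ := h
    have : formS k (mon k i j) = (shiftN k ^ i * signD k ^ j) 2 0 * (shiftN k ^ j) 2 0 := by
      simp [formS, mon, rhoB_x, rhoB_y, kron_pow, ← Matrix.mul_kronecker_mul]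
    rw [this]
    interval_cases i <;> interval_cases j <;>
      simp [shiftN, signD, pow_succ, Matrix.mul_apply, Fin.sum_univ_three]

lemma formS_comm_of_mon (k : Type) [Field k] (v : Balg k)
    (h : ∀ i j, formS k (mon k i j * v) = formS k (v * mon k i j)) (u : Balg k) :
    formS k (u * v) = formS k (v * u) := by
  have hu := mem_monSpan k u
  induction hu using Submodule.span_induction with
  | mem w hw => obtain ⟨p, rfl⟩ := hw; exact h _ _
  | zero => simp
  | add a b _ _ ha hb => rw [mul_add, add_mul, map_add, map_add, ha, hb]
  | smul c a _ ha => rw [mul_smul_comm, smul_mul_assoc, map_smul, map_smul, ha]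

lemma formS_comm (k : Type) [Field k] (u v : Balg k) :
    formS k (u * v) = formS k (v * u) := by
  obtain ⟨a, rfl⟩ := RingQuot.mkAlgHom_surjective k (Brel k) v
  induction a using FreeAlgebra.induction generalizing u with
  | grade0 r => rw [AlgHom.commutes, Algebra.commutes]
  | grade1 t =>
    fin_cases t
    · change formS k (u * xB k) = formS k (xB k * u)
      refine formS_comm_of_mon k _ (fun i j => ?_) u
      rw [mon_x, x_mon, map_smul, formS_mon]
      split_ifs with h
      · simp [h.2]
      · simp
    · change formS k (u * yB k) = formS k (yB k * u)
      refine formS_comm_of_mon k _ (fun i j => ?_) u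
      rw [mon_y, y_mon, map_smul, formS_mon]
      split_ifs with h
      · simp [h.1]
      · simp
  | mul a b ha hb => rw [map_mul (RingQuot.mkAlgHom k (Brel k)), ← mul_assoc, hb, ← mul_assoc, ha, mul_assoc]
  | add a b ha hb => rw [map_add, mul_add, add_mul, map_add, map_add, ha, hb]

lemma formS_nondeg (k : Type) [Field k] (u : Balg k)
    (h : ∀ w, formS k (w * u) = 0) : u = 0 := by
  obtain ⟨c, rfl⟩ := (Submodule.mem_span_range_iff_exists_fun k).1 (mem_monSpan k u)
  refine Finset.sum_eq_zero fun p _ => ?_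
  suffices hc : c p = 0 by rw [hc, zero_smul]
  have hp := h (xB k ^ (2 - (p.1 : ℕ)) * yB k ^ (2 - (p.2 : ℕ)))
  rw [Finset.mul_sum, map_sum, Finset.sum_eq_single p] at hp
  · rw [mul_smul_comm, mul_assoc, ypow_mon, mul_smul_comm, xpow_mon, map_smul, map_smul,
      formS_mon, if_pos (by omega)] at hp
    simpa using hp
  · intro q _ hq
    rw [mul_smul_comm, mul_assoc, ypow_mon, mul_smul_comm, xpow_mon, map_smul, map_smul,
      formS_mon, if_neg, smul_zero, smul_zero]
    intro hh
    apply hq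
    ext <;> omega
  · intro hp'; exact absurd (Finset.mem_univ _) hp'

/-- B is a symmetric algebra: the linear form sending x²y² to 1 and the other
monomials of the standard basis to 0 is a symmetrizing form. -/
theorem stmt13 (k : Type) [Field k] [CharP k 3] :
    ∃ s : Balg k →ₗ[k] k,
      s (xB k ^ 2 * yB k ^ 2) = 1 ∧
      s 1 = 0 ∧ s (xB k) = 0 ∧ s (yB k) = 0 ∧ s (xB k ^ 2) = 0 ∧
      s (xB k * yB k) = 0 ∧ s (yB k ^ 2) = 0 ∧
      s (xB k ^ 2 * yB k) = 0 ∧ s (xB k * yB k ^ 2) = 0 ∧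
      (∀ u v : Balg k, s (u * v) = s (v * u)) ∧
      (∀ I : Ideal (Balg k), (∀ a ∈ I, s a = 0) → I = ⊥) := by
  have m := formS_mon k
  refine ⟨formS k, ?_, ?_, ?_, ?_, ?_, ?_, ?_, ?_, ?_, formS_comm k, ?_⟩
  · simpa [mon] using m 2 2
  · simpa [mon] using m 0 0
  · simpa [mon] using m 1 0
  · simpa [mon] using m 0 1
  · simpa [mon] using m 2 0
  · simpa [mon] using m 1 1
  · simpa [mon] using m 0 2
  · simpa [mon] using m 2 1
  · simpa [mon] using m 1 2
  · intro I hI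
    rw [eq_bot_iff]
    intro u hu
    exact formS_nondeg k u fun w => hI _ (I.mul_mem_left w hu)
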